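/- arXiv:1602.08659 — 5 statements merged into one kernel-verified Lean document; each statement's English description precedes it below -/
import Mathlib

section
/- Let a_i(N,x) for 0 ≤ i ≤ N be defined recursively by a_0(0,x) = 1, a_0(N+1,x) = -(N+1)a_0(N,x), a_{N+1}(N+1,x) = (x-N)a_N(N,x), and a_i(N+1,x) = (x+1-i)a_{i-1}(N,x) + (i-N-1)a_i(N,x) for 1 ≤ i ≤ N. Then for every N ≥ 1 and every j with 1 ≤ j ≤ N, the rolled-up recurrence a_j(N+1,x) = (x-j+1) · Σ_{i=0}^{N-j+1} (-1)^i · (N-j+1)_i · a_{j-1}(N-i,x) holds, where (m)_i = m(m-1)⋯(m-i+1) is the falling factorial (with (m)_0 = 1). -/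
/-- The rolled-up recurrence, indexed by the distance `m` from the diagonal. -/
theorem rolled_recurrence_diagonal (x : ℝ) (a : ℕ → ℕ → ℝ)
    (htop : ∀ N : ℕ, a (N + 1) (N + 1) = (x - N) * a N N)
    (hmid : ∀ N i : ℕ, 1 ≤ i → i ≤ N →
      a (N + 1) i = (x + 1 - i) * a N (i - 1) + ((i : ℝ) - N - 1) * a N i) (k m : ℕ) :
    a (k + m + 1) (k + 1) =
      (x - k) * ∑ i ∈ Finset.range (m + 1),
        (-1) ^ i * (∏ r ∈ Finset.range i, ((m : ℝ) - r)) * a (k + m - i) k := by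
  induction m with
  | zero => simpa using htop k
  | succ m ih =>
    have h := hmid (k + m + 1) (k + 1) (by omega) (by omega)
    rw [ih, Nat.add_sub_cancel] at h
    rw [← add_assoc, h, Finset.sum_range_succ' _ (m + 1)]
    have hs : ∑ i ∈ Finset.range (m + 1),
        (-1) ^ (i + 1) * (∏ r ∈ Finset.range (i + 1), (((m + 1 : ℕ) : ℝ) - r)) *
          a (k + m + 1 - (i + 1)) k =
        -((m : ℝ) + 1) * ∑ i ∈ Finset.range (m + 1),
          (-1) ^ i * (∏ r ∈ Finset.range i, ((m : ℝ) - r)) * a (k + m - i) k := by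
      rw [Finset.mul_sum]
      refine Finset.sum_congr rfl fun i _ => ?_
      rw [Finset.prod_range_succ', Nat.add_sub_add_right]
      push_cast
      simp only [add_sub_add_right_eq_sub, sub_zero]
      ring
    rw [hs]
    push_cast
    simp only [pow_zero, Finset.range_zero, Finset.prod_empty]
    ring

/-- for `N ≥ 1` and `1 ≤ j ≤ N`, the rolled-up recurrence
`a_j(N+1,x) = (x-j+1) · Σ_{i=0}^{N-j+1} (-1)^i (N-j+1)_i a_{j-1}(N-i,x)`,
where `(m)_i` is the falling factorial. -/
theorem a_rolled_recurrence (x : ℝ) (a : ℕ → ℕ → ℝ)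
    (h00 : a 0 0 = 1)
    (h0 : ∀ N : ℕ, a (N + 1) 0 = -((N : ℝ) + 1) * a N 0)
    (htop : ∀ N : ℕ, a (N + 1) (N + 1) = (x - N) * a N N)
    (hmid : ∀ N i : ℕ, 1 ≤ i → i ≤ N →
      a (N + 1) i = (x + 1 - i) * a N (i - 1) + ((i : ℝ) - N - 1) * a N i) :
    ∀ N : ℕ, 1 ≤ N → ∀ j : ℕ, 1 ≤ j → j ≤ N →
      a (N + 1) j =
        (x - j + 1) *
          ∑ i ∈ Finset.range (N - j + 2),
            (-1) ^ i * (∏ r ∈ Finset.range i, (((N : ℝ) - j + 1) - r))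
              * a (N - i) (j - 1) := by
  intro N _ j hj hjN
  obtain ⟨k, rfl⟩ := Nat.exists_eq_add_of_le' hj
  obtain ⟨m, rfl⟩ := Nat.exists_eq_add_of_le hjN
  have h := rolled_recurrence_diagonal x a htop hmid k (m + 1)
  rw [show k + 1 + m = k + (m + 1) by omega, h, show k + (m + 1) - (k + 1) + 2 = m + 1 + 1 by omega,
    Nat.add_sub_cancel]
  push_cast
  rw [show x - ((k : ℝ) + 1) + 1 = x - k by ring,
    show (k : ℝ) + (m + 1) - (k + 1) + 1 = m + 1 by ring]
end

section
/- Let a_i(N,x) for 0 ≤ i ≤ N be defined recursively by a_0(0,x) = 1, a_0(N+1,x) = -(N+1)a_0(N,x), a_{N+1}(N+1,x) = (x-N)a_N(N,x), and a_i(N+1,x) = (x+1-i)a_{i-1}(N,x) + (i-N-1)a_i(N,x) for 1 ≤ i ≤ N. Then for every N ≥ 1 and every j with 1 ≤ j ≤ N, the closed-form formula a_j(N,x) = (x)_j · (-1)^{N-j} · (N-j)! · Σ (N - i_{j-1} - i_{j-2} - ⋯ - i_1 - j + 1) holds, where the sum runs over all (j-1)-tuples (i_1, …, i_{j-1}) of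 nonnegative integers with i_1 + ⋯ + i_{j-1} ≤ N - j (for j = 1, the sum is the single term N - j + 1 = N), and (x)_j = x(x-1)⋯(x-j+1) is the falling factorial. -/
/-- Summing over the tuples with entries below `K` and sum at most `M` the number of admissible
values for one more entry counts the `(n + 1)`-tuples with sum at most `M`, as long as `M < K`. -/
theorem sum_piFinset_range_filter_sum_le (n : ℕ) : ∀ M K : ℕ, M < K →
    ∑ v ∈ (Fintype.piFinset fun _ : Fin n => Finset.range K).filter (fun v => ∑ k, v k ≤ M),
      ((M : ℝ) - (∑ k, (v k : ℝ)) + 1) = ((M + n + 1).choose (n + 1) : ℝ) := by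
  induction n with
  | zero =>
    intro M K _
    simp
  | succ n ih =>
    intro M K hMK
    have h_split : ∑ v ∈ (Fintype.piFinset fun _ : Fin (n + 1) => Finset.range K).filter
          (fun v => ∑ k, v k ≤ M), ((M : ℝ) - (∑ k, (v k : ℝ)) + 1) =
        ∑ i ∈ Finset.range (M + 1),
          ∑ w ∈ (Fintype.piFinset fun _ : Fin n => Finset.range K).filter
            (fun w => ∑ k, w k ≤ M - i), (((M - i : ℕ) : ℝ) - (∑ k, (w k : ℝ)) + 1) := by
      rw [Finset.sum_sigma']
      refine Finset.sum_bij' (fun v _ => ⟨v 0, Fin.tail v⟩) (fun p _ => Fin.cons p.1 p.2)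
        ?_ ?_ ?_ ?_ ?_
      · intro v hv
        simp only [Finset.mem_filter, Fintype.mem_piFinset, Finset.mem_range, Finset.mem_sigma,
          Fin.sum_univ_succ, Fin.tail] at hv ⊢
        exact ⟨by omega, fun k => hv.1 k.succ, by omega⟩
      · rintro ⟨i, w⟩ hp
        simp only [Finset.mem_filter, Fintype.mem_piFinset, Finset.mem_range, Finset.mem_sigma,
          Fin.sum_univ_succ, Fin.cons_zero, Fin.cons_succ, Fin.forall_fin_succ] at hp ⊢
        exact ⟨⟨by omega, hp.2.1⟩, by omega⟩
      · intro v _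
        exact Fin.cons_self_tail v
      · rintro ⟨i, w⟩ _
        simp
      · intro v hv
        simp only [Finset.mem_filter, Fin.sum_univ_succ] at hv
        simp only [Fin.sum_univ_succ, Fin.tail]
        rw [Nat.cast_sub (by omega)]
        ring
    rw [h_split, Finset.sum_congr rfl fun i _ => ih (M - i) K (by omega),
      ← Finset.sum_range_reflect, ← Nat.cast_sum]
    congr 1
    rw [← Nat.sum_range_add_choose]
    refine Finset.sum_congr rfl fun i hi => ?_
    rw [Finset.mem_range] at hi
    congr 1
    omega

/-- Closed form of the coefficients in terms of a binomial coefficient. -/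
theorem eq_prod_sub_mul_factorial_mul_choose (x : ℝ) (a : ℕ → ℕ → ℝ)
    (h00 : a 0 0 = 1)
    (h0 : ∀ N : ℕ, a (N + 1) 0 = -((N : ℝ) + 1) * a N 0)
    (htop : ∀ N : ℕ, a (N + 1) (N + 1) = (x - N) * a N N)
    (hmid : ∀ N i : ℕ, 1 ≤ i → i ≤ N →
      a (N + 1) i = (x + 1 - i) * a N (i - 1) + ((i : ℝ) - N - 1) * a N i) (N : ℕ) :
    ∀ j ≤ N, a N j =
      (∏ k ∈ Finset.range j, (x - k)) * (-1) ^ (N - j) * (N - j).factorial * N.choose j := by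
  induction N with
  | zero =>
    intro j hj
    obtain rfl : j = 0 := by omega
    simp [h00]
  | succ N ih =>
    rintro (_ | i) hj
    · rw [h0, ih 0 (Nat.zero_le N)]
      simp [Nat.factorial_succ, pow_succ]
      ring
    · obtain rfl | hlt := (Nat.le_of_succ_le_succ hj).eq_or_lt
      · rw [htop, ih i le_rfl]
        simp [Finset.prod_range_succ]
        ring
      · obtain ⟨d, rfl⟩ := Nat.exists_eq_add_of_lt hlt
        rw [hmid _ _ (by omega) (by omega), ih (i + 1) (by omega), Nat.add_sub_cancel,
          ih i (by omega), show i + d + 1 - i = d + 1 by omega,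
          show i + d + 1 - (i + 1) = d by omega,
          show i + d + 1 + 1 - (i + 1) = d + 1 by omega, Nat.choose_succ_succ (i + d + 1) i,
          Nat.factorial_succ, Finset.prod_range_succ]
        push_cast
        ring


/-- for `N ≥ 1` and `1 ≤ j ≤ N`, the closed form
`a_j(N,x) = (x)_j (-1)^{N-j} (N-j)! · Σ (N - i_{j-1} - ⋯ - i_1 - j + 1)`,
the sum over all `(j-1)`-tuples of nonnegative integers with
`i_1 + ⋯ + i_{j-1} ≤ N - j`. -/
theorem a_closed_form (x : ℝ) (a : ℕ → ℕ → ℝ)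
    (h00 : a 0 0 = 1)
    (h0 : ∀ N : ℕ, a (N + 1) 0 = -((N : ℝ) + 1) * a N 0)
    (htop : ∀ N : ℕ, a (N + 1) (N + 1) = (x - N) * a N N)
    (hmid : ∀ N i : ℕ, 1 ≤ i → i ≤ N →
      a (N + 1) i = (x + 1 - i) * a N (i - 1) + ((i : ℝ) - N - 1) * a N i) :
    ∀ N : ℕ, 1 ≤ N → ∀ j : ℕ, 1 ≤ j → j ≤ N →
      a N j =
        (∏ k ∈ Finset.range j, (x - k)) * (-1) ^ (N - j) * (N - j).factorial *
          ∑ v ∈ (Fintype.piFinset fun _ : Fin (j - 1) =>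
              Finset.range (N - j + 1)).filter (fun v => ∑ k, v k ≤ N - j),
            ((N : ℝ) - (∑ k, (v k : ℝ)) - j + 1) := by
  intro N _ j hj hjN
  rw [eq_prod_sub_mul_factorial_mul_choose x a h00 h0 htop hmid N j hjN]
  have h := sum_piFinset_range_filter_sum_le (j - 1) (N - j) (N - j + 1) (Nat.lt_succ_self _)
  rw [show N - j + (j - 1) + 1 = N by omega, Nat.sub_add_cancel hj] at h
  rw [← h]
  congr 1
  refine Finset.sum_congr rfl fun v _ => ?_
  rw [Nat.cast_sub hjN]
  ring
end

section
/- (Theorem 2.1) Let F(t,x) = (1+t)^x/(2+t) for t ∈ (-1,∞) and x ∈ ℝ. Define a_0(N,x) = (-1)^N · N!, and for 1 ≤ j ≤ N define a_j(N,x) = (x)_j · (-1)^{N-j} · (N-j)! · Σ (N - i_{j-1} - ⋯ - i_1 - j + 1), where the sum runs over all (j-1)-tuples (i_1, …, i_{j-1}) of nonnegative integers with i_1 + ⋯ + i_{j-1} ≤ N - j (for j = 1, the sum is the single term N), and (x)_j = x(x-1)⋯(x-j+1) is the falling factorial. Then for every N ≥ 0 and every t ∈ (-1,∞), the N-th derivative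 of F with respect to t satisfies F^{(N)}(t,x) = (Σ_{i=0}^{N} a_i(N,x)·(1+t)^{-i}·(2+t)^{i-N}) · F(t,x). -/
/-- The explicit coefficients of Theorem 2.1: `aCoeff x N 0 = (-1)^N N!` and, for
`1 ≤ j ≤ N`, `aCoeff x N j = (x)_j (-1)^{N-j} (N-j)! Σ (N - i_{j-1} - ⋯ - i_1 - j + 1)`,
the sum over `(j-1)`-tuples of nonnegative integers with `i_1 + ⋯ + i_{j-1} ≤ N-j`. -/
noncomputable def aCoeff (x : ℝ) (N j : ℕ) : ℝ :=
  if j = 0 then (-1) ^ N * N.factorial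
  else
    (∏ k ∈ Finset.range j, (x - k)) * (-1) ^ (N - j) * (N - j).factorial *
      ∑ v ∈ (Fintype.piFinset fun _ : Fin (j - 1) =>
          Finset.range (N - j + 1)).filter (fun v => ∑ k, v k ≤ N - j),
        ((N : ℝ) - (∑ k, (v k : ℝ)) - j + 1)

/-- Weighted count of the points of the discrete simplex of dimension `d` and size `M`. -/
theorem sum_simplex_eq_choose (d M B : ℕ) (hB : M < B) :
    ∑ v ∈ (Fintype.piFinset fun _ : Fin d => Finset.range B).filter
        (fun v => ∑ k, v k ≤ M), (M - ∑ k, v k + 1) = (M + d + 1).choose (d + 1) := by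
  induction d generalizing M with
  | zero => simp
  | succ d ih =>
    have fiber : ∑ v ∈ (Fintype.piFinset fun _ : Fin (d + 1) => Finset.range B).filter
          (fun v => ∑ k, v k ≤ M), (M - ∑ k, v k + 1) =
        ∑ p ∈ (Finset.range (M + 1)).sigma fun a =>
          (Fintype.piFinset fun _ : Fin d => Finset.range B).filter
            (fun v => ∑ k, v k ≤ M - a), (M - p.1 - ∑ k, p.2 k + 1) := by
      refine Finset.sum_bij' (fun v _ => ⟨v 0, Fin.tail v⟩)
        (fun p _ => (Fin.cons p.1 p.2 : Fin (d + 1) → ℕ)) ?_ ?_ ?_ ?_ ?_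
      · intro v hv
        simp only [Finset.mem_filter, Fintype.mem_piFinset, Finset.mem_range, Fin.sum_univ_succ,
          Finset.mem_sigma, Fin.tail] at hv ⊢
        exact ⟨by omega, fun a => hv.1 _, by omega⟩
      · rintro ⟨a, v⟩ hv
        simp only [Finset.mem_filter, Fintype.mem_piFinset, Finset.mem_range, Fin.sum_univ_succ,
          Finset.mem_sigma, Fin.forall_fin_succ, Fin.cons_zero, Fin.cons_succ] at hv ⊢
        exact ⟨⟨by omega, hv.2.1⟩, by omega⟩
      · intro v _
        exact Fin.cons_self_tail v
      · rintro ⟨a, v⟩ _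
        simp
      · intro v _
        simp [Fin.sum_univ_succ, Fin.tail, Nat.sub_sub]
    rw [fiber, Finset.sum_sigma, Finset.sum_congr rfl fun a _ => ih (M - a) (by omega),
      ← Finset.sum_range_reflect]
    calc _ = ∑ i ∈ Finset.range (M + 1), (i + (d + 1)).choose (d + 1) := by
          refine Finset.sum_congr rfl fun i hi => ?_
          rw [Finset.mem_range] at hi
          congr 1
          omega
      _ = _ := Nat.sum_range_add_choose M (d + 1)

theorem aCoeff_eq_choose (x : ℝ) {N j : ℕ} (hj : j ≤ N) :
    aCoeff x N j = N.choose j * (∏ k ∈ Finset.range j, (x - k)) *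
      ((-1) ^ (N - j) * (N - j).factorial) := by
  rcases j with _ | d
  · simp [aCoeff]
  have key : ∑ v ∈ (Fintype.piFinset fun _ : Fin d =>
      Finset.range (N - (d + 1) + 1)).filter (fun v => ∑ k, v k ≤ N - (d + 1)),
        ((N : ℝ) - (∑ k, (v k : ℝ)) - ((d + 1 : ℕ) : ℝ) + 1) = N.choose (d + 1) := by
    have h := sum_simplex_eq_choose d (N - (d + 1)) (N - (d + 1) + 1) (Nat.lt_succ_self _)
    rw [show N - (d + 1) + d + 1 = N by omega] at h
    rw [← h, Nat.cast_sum]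
    refine Finset.sum_congr rfl fun v hv => ?_
    rw [Nat.cast_add (N - (d + 1) - _), Nat.cast_sub (Finset.mem_filter.1 hv).2, Nat.cast_sub hj]
    push_cast
    ring
  rw [aCoeff, if_neg (Nat.succ_ne_zero d)]
  refine (congrArg (_ * ·) key).trans ?_
  ring

theorem iteratedDeriv_const_add_rpow (c x t : ℝ) (n : ℕ) :
    iteratedDeriv n (fun s : ℝ => (c + s) ^ x) t =
      (∏ k ∈ Finset.range n, (x - k)) * (c + t) ^ (x - n) := by
  rw [iteratedDeriv_comp_const_add n (fun s : ℝ => s ^ x) c, iteratedDeriv_eq_iterate]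
  beta_reduce
  rw [Real.iter_deriv_rpow_const, descPochhammer_eval_eq_prod_range]

theorem iteratedDeriv_const_add_inv (c t : ℝ) (n : ℕ) :
    iteratedDeriv n (fun s : ℝ => (c + s)⁻¹) t =
      (-1) ^ n * n.factorial * (c + t) ^ (-1 - n : ℤ) := by
  rw [iteratedDeriv_comp_const_add n (fun s : ℝ => s⁻¹) c, iteratedDeriv_eq_iterate]
  exact iter_deriv_inv n (c + t)

/-- Theorem 2.1: for every `N ≥ 0` and `t ∈ (-1,∞)`,
`F^{(N)}(t,x) = (Σ_{i=0}^N a_i(N,x) (1+t)^{-i} (2+t)^{i-N}) · F(t,x)`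
where `F(t,x) = (1+t)^x/(2+t)`. -/
theorem iteratedDeriv_changhee_gen_explicit (x : ℝ) :
    ∀ N : ℕ, ∀ t : ℝ, -1 < t →
      iteratedDeriv N (fun s : ℝ => (1 + s) ^ x / (2 + s)) t =
        (∑ i ∈ Finset.range (N + 1),
            aCoeff x N i * (1 + t) ^ (-(i : ℤ)) * (2 + t) ^ ((i : ℤ) - N))
          * ((1 + t) ^ x / (2 + t)) := by
  intro N t ht
  have h1 : 0 < 1 + t := by linarith
  have h2 : 0 < 2 + t := by linarith
  have hf : ContDiffAt ℝ N (fun s : ℝ => (1 + s) ^ x) t :=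
    (contDiffAt_const.add contDiffAt_id).rpow_const_of_ne h1.ne'
  have hg : ContDiffAt ℝ N (fun s : ℝ => (2 + s)⁻¹) t :=
    (contDiffAt_const.add contDiffAt_id).inv h2.ne'
  simp only [div_eq_mul_inv]
  rw [iteratedDeriv_fun_mul hf hg, Finset.sum_mul]
  refine Finset.sum_congr rfl fun i hi => ?_
  have hi : i ≤ N := Nat.lt_succ_iff.1 (Finset.mem_range.1 hi)
  rw [aCoeff_eq_choose x hi, iteratedDeriv_const_add_rpow, iteratedDeriv_const_add_inv,
    Real.rpow_sub h1, Real.rpow_natCast, zpow_neg, zpow_natCast, div_eq_mul_inv,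
    show (-1 - (N - i : ℕ) : ℤ) = (i - N) + (-1) by push_cast [Nat.cast_sub hi]; ring,
    zpow_add₀ h2.ne', zpow_neg_one]
  ring
end

section
/- Let the Changhee polynomials Ch_n(x) be defined by Ch_0(x) = 1 and the recurrence 2·Ch_n(x) + n·Ch_{n-1}(x) = 2·(x)_n for n ≥ 1, where (x)_n = x(x-1)⋯(x-n+1) is the falling factorial. Then for every x ∈ ℝ and every t with |t| < 1, the series Σ_{n=0}^{∞} Ch_n(x)·t^n/n! converges to 2(1+t)^x/(2+t), where (1+t)^x is the real power. -/
theorem Ring.choose_real_eq_prod_div_factorial (x : ℝ) (n : ℕ) :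
    Ring.choose x n = (∏ k ∈ Finset.range n, (x - k)) / n.factorial := by
  rw [Ring.choose_eq_smul, ← descPochhammer_eval_eq_prod_range, ← Polynomial.aeval_eq_smeval,
    Polynomial.aeval_def, ← Polynomial.eval_map, algebraMap_int_eq, descPochhammer_map,
    smul_eq_mul, inv_mul_eq_div]

/-- The binomial series in terms of falling factorials. -/
theorem Real.hasSum_prod_sub_mul_pow_div_factorial (x : ℝ) {t : ℝ} (ht : |t| < 1) :
    HasSum (fun n : ℕ => (∏ k ∈ Finset.range n, (x - k)) / n.factorial * t ^ n)
      ((1 + t) ^ x) := by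
  have h := (Real.one_add_rpow_hasFPowerSeriesOnBall_zero (a := x)).hasSum (y := t)
    (by simpa [enorm_eq_nnnorm, ← NNReal.coe_lt_coe] using ht)
  simpa only [binomialSeries_apply, Ring.choose_real_eq_prod_div_factorial, smul_eq_mul,
    List.ofFn_const, List.prod_replicate, zero_add] using h

/-- A sequence satisfying `a (n + 1) = b (n + 1) + r * a n` is the convolution of `b` with the
geometric sequence of ratio `r`. -/
theorem eq_sum_antidiagonal_pow_mul_of_rec {R : Type*} [CommSemiring R] {a b : ℕ → R} {r : R}
    (h0 : a 0 = b 0) (hrec : ∀ n, a (n + 1) = b (n + 1) + r * a n) (n : ℕ) :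
    a n = ∑ p ∈ Finset.HasAntidiagonal.antidiagonal n, r ^ p.1 * b p.2 := by
  induction n with
  | zero => simp [h0]
  | succ n ih =>
    rw [hrec, ih, Finset.Nat.sum_antidiagonal_succ, Finset.mul_sum]
    simp [pow_succ', mul_assoc]

/-- with the Changhee polynomials given by `Ch_0(x) = 1` and
`2·Ch_n(x) + n·Ch_{n-1}(x) = 2·(x)_n` for `n ≥ 1`, the series
`Σ_{n≥0} Ch_n(x) t^n/n!` converges to `2(1+t)^x/(2+t)` for `|t| < 1`. -/
theorem changhee_generating_function (Ch : ℕ → ℝ → ℝ)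
    (hCh0 : ∀ x : ℝ, Ch 0 x = 1)
    (hChrec : ∀ (n : ℕ) (x : ℝ),
      2 * Ch (n + 1) x + (n + 1) * Ch n x =
        2 * ∏ k ∈ Finset.range (n + 1), (x - k)) :
    ∀ (x t : ℝ), |t| < 1 →
      HasSum (fun n : ℕ => Ch n x * t ^ n / n.factorial)
        (2 * (1 + t) ^ x / (2 + t)) := by
  intro x t ht
  have hb := Real.hasSum_prod_sub_mul_pow_div_factorial x ht
  have hr : ‖-t / 2‖ < 1 := by
    rw [norm_div, norm_neg, Real.norm_eq_abs, Real.norm_eq_abs, abs_two]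
    linarith
  have hg := hasSum_geometric_of_norm_lt_one hr
  have hgn := hg.summable.norm
  have hbn := hb.summable.norm
  have hconv := (summable_norm_sum_mul_antidiagonal_of_summable_norm hgn hbn).of_norm.hasSum
  rw [← tsum_mul_tsum_eq_tsum_sum_antidiagonal_of_summable_norm hgn hbn,
    hg.tsum_eq, hb.tsum_eq] at hconv
  have hrec (n : ℕ) : Ch (n + 1) x * t ^ (n + 1) / (n + 1).factorial =
      (∏ k ∈ Finset.range (n + 1), (x - k)) / (n + 1).factorial * t ^ (n + 1) +
        -t / 2 * (Ch n x * t ^ n / n.factorial) := by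
    have hprod : ∏ k ∈ Finset.range (n + 1), (x - (k : ℝ)) =
        Ch (n + 1) x + (n + 1) / 2 * Ch n x := by
      linarith [hChrec n x]
    rw [hprod, Nat.factorial_succ]
    push_cast
    field_simp
    ring
  have hval : 2 * (1 + t) ^ x / (2 + t) = (1 - -t / 2)⁻¹ * (1 + t) ^ x := by
    have hpos : 0 < 2 + t := by linarith [(abs_lt.mp ht).1]
    rw [show 1 - -t / 2 = (2 + t) / 2 by ring, inv_div]
    ring
  rw [hval]
  refine hconv.congr_fun fun n => ?_
  exact eq_sum_antidiagonal_pow_mul_of_rec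
    (a := fun n => Ch n x * t ^ n / n.factorial)
    (b := fun n => (∏ k ∈ Finset.range n, (x - k)) / n.factorial * t ^ n)
    (by simp [hCh0]) hrec n
end

section
/- Let the Changhee polynomials Ch_n(x) be defined by Ch_0(x) = 1 and the recurrence 2·Ch_n(x) + n·Ch_{n-1}(x) = 2·(x)_n for n ≥ 1, where (x)_n is the falling factorial. Then for every x ∈ ℝ and every N ≥ 0, the N-th derivative with respect to t of the function t ↦ 2(1+t)^x/(2+t), evaluated at t = 0, equals Ch_N(x). -/
theorem iteratedDeriv_succ_const_add_mul {f : ℝ → ℝ} {x : ℝ} (a : ℝ) (n : ℕ)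
    (hf : ContDiffAt ℝ (n + 1 : ℕ) f x) :
    iteratedDeriv (n + 1) (fun t => (a + t) * f t) x =
      (a + x) * iteratedDeriv (n + 1) f x + (n + 1) * iteratedDeriv n f x := by
  have hlin : ContDiffAt ℝ (n + 1 : ℕ) (fun t : ℝ => a + t) x := by fun_prop
  rw [iteratedDeriv_fun_mul hlin hf, Finset.sum_range_succ', Finset.sum_range_succ',
    Finset.sum_eq_zero]
  · simp [iteratedDeriv_one]
    ring
  · intro i _
    rw [iteratedDeriv_const_add (by lia), iteratedDeriv_fun_id]
    simp

theorem iteratedDeriv_one_add_rpow_zero (x : ℝ) (n : ℕ) :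
    iteratedDeriv n (fun t : ℝ => (1 + t) ^ x) 0 = ∏ k ∈ Finset.range n, (x - k) := by
  rw [iteratedDeriv_comp_const_add n (fun z : ℝ => z ^ x) 1, iteratedDeriv_eq_iterate]
  simp [Real.iter_deriv_rpow_const, descPochhammer_eval_eq_prod_range]

/-- the `N`-th derivative of `t ↦ 2(1+t)^x/(2+t)` at `t = 0`
equals the Changhee polynomial `Ch_N(x)`. -/
theorem changhee_iteratedDeriv_at_zero (Ch : ℕ → ℝ → ℝ)
    (hCh0 : ∀ x : ℝ, Ch 0 x = 1)
    (hChrec : ∀ (n : ℕ) (x : ℝ),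
      2 * Ch (n + 1) x + (n + 1) * Ch n x =
        2 * ∏ k ∈ Finset.range (n + 1), (x - k)) :
    ∀ (x : ℝ) (N : ℕ),
      iteratedDeriv N (fun t : ℝ => 2 * (1 + t) ^ x / (2 + t)) 0 = Ch N x := by
  intro x N
  have hpow : ∀ m : ℕ, ContDiffAt ℝ m (fun t : ℝ => 2 * (1 + t) ^ x) 0 := fun m =>
    contDiffAt_const.mul
      ((contDiffAt_const.add contDiffAt_id).rpow_const_of_ne (by simp))
  have hquot : ∀ m : ℕ, ContDiffAt ℝ m (fun t : ℝ => 2 * (1 + t) ^ x / (2 + t)) 0 := fun m =>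
    (hpow m).div (contDiffAt_const.add contDiffAt_id) (by simp)
  induction N with
  | zero => simp [hCh0]
  | succ n ih =>
    have hcancel : (fun t : ℝ => (2 + t) * (2 * (1 + t) ^ x / (2 + t)))
        =ᶠ[nhds 0] fun t => 2 * (1 + t) ^ x := by
      filter_upwards [lt_mem_nhds (show (-2 : ℝ) < 0 by norm_num)] with t ht
      exact mul_div_cancel₀ _ (by linarith)
    have h := hcancel.iteratedDeriv_eq (n + 1)
    rw [iteratedDeriv_succ_const_add_mul 2 n (hquot _), iteratedDeriv_const_mul_field,
      iteratedDeriv_one_add_rpow_zero, ih] at h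
    linarith [hChrec n x]
end
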